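/- Let G be a group, N ⊴ G a normal subgroup such that G/N is virtually infinite cyclic (contains a finite-index infinite cyclic subgroup), and suppose N is finitely generated. Let ψ : G → ℤ be a surjective homomorphism with N ≤ ker ψ. Then ker ψ is finitely generated. -/

import Mathlib

theorem Group.fg_of_finiteIndex {G : Type*} [Group G] (H : Subgroup G) [H.FiniteIndex]
    (hH : H.FG) : Group.FG G := by
  let T : Set G := Set.range (Quotient.out : G ⧸ H → G)
  have : Finite T := @Set.finite_range _ (G ⧸ H) _ inferInstance
  have hT : (Subgroup.closure T).FG :=
    (Group.fg_iff_subgroup_fg _).1 (Group.closure_finite_fg T)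
  rw [Group.fg_def]
  convert hH.sup hT
  refine (eq_top_iff.2 fun g _ ↦ ?_).symm
  obtain ⟨h, hh⟩ := QuotientGroup.mk_out_eq_mul H g
  have hg : g = (g : G ⧸ H).out * (h : G)⁻¹ := by simp [hh]
  rw [hg]
  exact mul_mem (Subgroup.mem_sup_right (Subgroup.subset_closure (Set.mem_range_self _)))
    (Subgroup.mem_sup_left (inv_mem h.2))

/-- A surjection onto `ℤ` is injective on every infinite cyclic subgroup of finite index. -/
theorem Subgroup.eq_one_of_mem_ker_of_finiteIndex_of_equiv_int {Q : Type*} [Group Q]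
    (Z : Subgroup Q) [Z.FiniteIndex] (e : Z ≃* Multiplicative ℤ) (φ : Q →* Multiplicative ℤ)
    (hφ : Function.Surjective φ) {x : Q} (hxZ : x ∈ Z) (hx : φ x = 1) : x = 1 := by
  let z : Z := e.symm (Multiplicative.ofAdd 1)
  have hpow (y : Z) : y = z ^ (e y).toAdd := by
    apply e.injective
    rw [map_zpow, e.apply_symm_apply, ← ofAdd_zsmul]
    simp
  have hz : φ z ≠ 1 := by
    intro hz
    have hle : Z ≤ φ.ker := by
      intro y hy
      have h := congrArg (fun w : Z ↦ φ w) (hpow ⟨y, hy⟩)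
      simpa [hz] using h
    have := Subgroup.finiteIndex_of_le hle
    apply this.index_ne_zero
    rw [Subgroup.index_ker, MonoidHom.range_eq_top.2 hφ, Subgroup.card_top]
    exact Nat.card_eq_zero_of_infinite
  have h := congrArg (fun w : Z ↦ (φ w).toAdd) (hpow ⟨x, hxZ⟩)
  simp only [hx, Subgroup.coe_zpow, map_zpow, toAdd_one, toAdd_zpow, smul_eq_mul] at h
  rcases mul_eq_zero.1 h.symm with h | h
  · have := e.map_eq_one_iff.1 (toAdd_eq_zero.1 h)
    simpa using this
  · exact absurd (toAdd_eq_zero.1 h) hz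

theorem kernel_fg_of_virtually_cyclic_quotient
    (G : Type*) [Group G] (N : Subgroup G) [N.Normal]
    (hNfg : Group.FG N)
    (hvz : ∃ Z : Subgroup (G ⧸ N), Z.FiniteIndex ∧ Nonempty (Z ≃* Multiplicative ℤ))
    (ψ : G →* Multiplicative ℤ) (hsurj : Function.Surjective ψ)
    (hNker : N ≤ ψ.ker) :
    Group.FG ψ.ker := by
  obtain ⟨Z, hZ, ⟨e⟩⟩ := hvz
  have hH : (Z.comap (QuotientGroup.mk' N)).FiniteIndex := by
    refine ⟨?_⟩
    rw [Subgroup.index_comap_of_surjective _ (QuotientGroup.mk'_surjective N)]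
    exact hZ.index_ne_zero
  have hlift : Function.Surjective (QuotientGroup.lift N ψ hNker) :=
    QuotientGroup.lift_surjective_of_surjective N ψ hsurj hNker
  have hle : (Z.comap (QuotientGroup.mk' N)).subgroupOf ψ.ker ≤ N.subgroupOf ψ.ker := by
    rintro ⟨g, hg⟩ hgZ
    exact (QuotientGroup.eq_one_iff g).1
      (Z.eq_one_of_mem_ker_of_finiteIndex_of_equiv_int e _ hlift hgZ hg)
  have := Subgroup.finiteIndex_of_le hle
  exact Group.fg_of_finiteIndex (N.subgroupOf ψ.ker) ((Group.fg_iff_subgroup_fg _).1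
    (Group.fg_of_surjective (f := (Subgroup.subgroupOfEquivOfLe hNker).symm.toMonoidHom)
      (MulEquiv.surjective _)))
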